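/- Let P be the probability measure on ℝ with P({1/k}) = 1/2^k for integers k ≥ 1. The third quantization error equals (2π² − 51 − 108 log²2 + 120 log 2)/24, attained at the set {a, 1/2, 1}, where a = E(X | X ∈ {1/k : k ≥ 3}). -/

import Mathlib

/-- Distortion error of a nonempty finite set α for the measure P({1/k}) = 1/2^k, k ≥ 1. -/
noncomputable def errR (α : Finset ℝ) (h : α.Nonempty) : ℝ :=
  ∑' k : ℕ, (1/2^(k+1) : ℝ) * α.inf' h (fun a => (1/(k+1 : ℝ) - a)^2)

/-- Conditional expectation E(X | X ∈ {1/k : k ≥ m}). -/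
noncomputable def avRTail (m : ℕ) : ℝ :=
  (∑' k : ℕ, (1/2^(k+m) : ℝ) * (1/(k+m : ℝ))) / (∑' k : ℕ, (1/2^(k+m) : ℝ))

theorem hasSum_of_eq {f g : ℕ → ℝ} {a b : ℝ} (h : HasSum f a) (hfg : ∀ n, g n = f n)
    (hab : b = a) : HasSum g b := by
  rw [funext hfg, hab]
  exact h

open Filter Topology Set in
/-- Euler's reflection formula for the dilogarithm, evaluated at `1 / 2`. -/
theorem hasSum_dilog_one_half :
    HasSum (fun n : ℕ => (1 / 2 ^ (n + 1) : ℝ) * (1 / ((n : ℝ) + 1)) ^ 2)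
      (Real.pi ^ 2 / 12 - Real.log 2 ^ 2 / 2) := by
  set D : ℝ → ℝ := fun x => ∑' n : ℕ, x ^ (n + 1) / ((n : ℝ) + 1) ^ 2 with hD
  have hzeta : HasSum (fun n : ℕ => 1 / ((n : ℝ) + 1) ^ 2) (Real.pi ^ 2 / 6) := by
    have h := (hasSum_nat_add_iff' (f := fun n : ℕ => 1 / (n : ℝ) ^ 2) 1).2 hasSum_zeta_two
    simpa using h
  have hbound : ∀ n : ℕ, ∀ x ∈ Icc (0 : ℝ) 1,
      ‖x ^ (n + 1) / ((n : ℝ) + 1) ^ 2‖ ≤ 1 / ((n : ℝ) + 1) ^ 2 := by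
    intro n x hx
    rw [Real.norm_of_nonneg (div_nonneg (pow_nonneg hx.1 _) (by positivity))]
    gcongr
    exact pow_le_one₀ hx.1 hx.2
  have hsum : ∀ x ∈ Icc (0 : ℝ) 1, Summable fun n : ℕ => x ^ (n + 1) / ((n : ℝ) + 1) ^ 2 :=
    fun x hx => Summable.of_norm_bounded hzeta.summable fun n => hbound n x hx
  have hcont : ContinuousOn D (Icc 0 1) :=
    continuousOn_tsum (fun n => by fun_prop) hzeta.summable hbound
  have hD0 : D 0 = 0 := by simp [hD]
  have hD1 : D 1 = Real.pi ^ 2 / 6 := by simpa [hD] using hzeta.tsum_eq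
  have hderiv : ∀ x ∈ Ioo (0 : ℝ) 1, HasDerivAt D (-Real.log (1 - x) / x) x := by
    intro x hx
    obtain ⟨r, hxr, hr1⟩ := exists_between hx.2
    have hr0 : 0 < r := hx.1.trans hxr
    have hs : HasSum (fun n : ℕ => x ^ n / ((n : ℝ) + 1)) (-Real.log (1 - x) / x) := by
      have h := (Real.hasSum_pow_div_log_of_abs_lt_one
        (by rw [abs_of_pos hx.1]; exact hx.2 : |x| < 1)).div_const x
      refine hasSum_of_eq h (fun n => ?_) rfl
      have := hx.1.ne'
      rw [pow_succ]
      field_simp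
    rw [← hs.tsum_eq]
    refine hasDerivAt_tsum_of_isPreconnected (t := Ioo (-r) r) (u := fun n => r ^ n) (y₀ := x)
      (g := fun (n : ℕ) (y : ℝ) => y ^ (n + 1) / ((n : ℝ) + 1) ^ 2)
      (g' := fun (n : ℕ) (y : ℝ) => y ^ n / ((n : ℝ) + 1))
      (summable_geometric_of_lt_one hr0.le hr1) isOpen_Ioo isPreconnected_Ioo ?_ ?_
      ⟨by linarith [hx.1], hxr⟩ (hsum x ⟨hx.1.le, hx.2.le⟩) ⟨by linarith [hx.1], hxr⟩
    · intro n y _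
      have h := (hasDerivAt_pow (n + 1) y).div_const (((n : ℝ) + 1) ^ 2)
      refine h.congr_deriv ?_
      have : (n : ℝ) + 1 ≠ 0 := by positivity
      push_cast
      field_simp
    · intro n y hy
      rw [norm_div, norm_pow, Real.norm_eq_abs, Real.norm_of_nonneg (by positivity)]
      calc |y| ^ n / ((n : ℝ) + 1) ≤ |y| ^ n := div_le_self (by positivity) (by simp)
        _ ≤ r ^ n := pow_le_pow_left₀ (abs_nonneg y) (abs_le.2 ⟨hy.1.le, hy.2.le⟩) n
  set G : ℝ → ℝ := fun x => D x + D (1 - x) + Real.log x * Real.log (1 - x) with hG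
  have hGderiv : ∀ x ∈ Ioo (0 : ℝ) 1, HasDerivAt G 0 x := by
    intro x hx
    have h1 : (1 - x) ∈ Ioo (0 : ℝ) 1 := ⟨by linarith [hx.2], by linarith [hx.1]⟩
    have hs : HasDerivAt (fun y : ℝ => 1 - y) (-1) x := by
      simpa using (hasDerivAt_id x).const_sub 1
    have h := ((hderiv x hx).add ((hderiv _ h1).comp x hs)).add
      ((Real.hasDerivAt_log hx.1.ne').mul (hs.log h1.1.ne'))
    refine h.congr_deriv ?_
    have := hx.1.ne'
    have := h1.1.ne'
    simp only [sub_sub_cancel]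
    field_simp
    ring
  have hGconst : ∀ x ∈ Ioo (0 : ℝ) 1, G x = G (1 / 2) := fun x hx =>
    isOpen_Ioo.is_const_of_deriv_eq_zero isPreconnected_Ioo
      (fun y hy => (hGderiv y hy).differentiableAt.differentiableWithinAt)
      (fun y hy => (hGderiv y hy).deriv) hx (by norm_num)
  have hmem : ∀ᶠ x : ℝ in 𝓝[>] 0, x ∈ Ioo (0 : ℝ) 1 := Ioo_mem_nhdsGT one_pos
  have hlim : Tendsto G (𝓝[>] 0) (𝓝 (0 + Real.pi ^ 2 / 6 + 0)) := by
    refine (Tendsto.add ?_ ?_).add ?_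
    · have h : Tendsto D (𝓝[Icc 0 1] 0) (𝓝 (D 0)) := hcont 0 (by simp)
      rw [hD0] at h
      refine h.comp (tendsto_nhdsWithin_iff.2 ⟨tendsto_id.mono_left nhdsWithin_le_nhds, ?_⟩)
      exact hmem.mono fun x hx => Ioo_subset_Icc_self hx
    · have h : Tendsto D (𝓝[Icc 0 1] 1) (𝓝 (D 1)) := hcont 1 (by simp)
      rw [hD1] at h
      refine h.comp (tendsto_nhdsWithin_iff.2 ⟨?_, ?_⟩)
      · have : Tendsto (fun x : ℝ => 1 - x) (𝓝 0) (𝓝 (1 - 0)) :=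
          (continuous_const.sub continuous_id).tendsto 0
        simpa using this.mono_left nhdsWithin_le_nhds
      · exact hmem.mono fun x hx => ⟨by linarith [hx.2], by linarith [hx.1]⟩
    · have h := (tendsto_log_mul_rpow_nhdsGT_zero one_pos).const_mul (-2)
      have hhalf : ∀ᶠ x : ℝ in 𝓝[>] 0, x ∈ Ioo (0 : ℝ) (1 / 2) := Ioo_mem_nhdsGT (by norm_num)
      simp only [mul_zero, Real.rpow_one] at h
      refine squeeze_zero' (hmem.mono fun x hx => ?_) (hhalf.mono fun x hx => ?_) h
      · exact mul_nonneg_of_nonpos_of_nonpos (Real.log_nonpos hx.1.le hx.2.le)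
          (Real.log_nonpos (by linarith [hx.2]) (by linarith [hx.1]))
      · have h1 : -(2 * x) ≤ Real.log (1 - x) := by
          have h2 := Real.one_sub_inv_le_log_of_pos (show 0 < 1 - x by linarith [hx.2])
          have h3 : (1 - x)⁻¹ ≤ 1 + 2 * x := by
            rw [inv_le_iff_one_le_mul₀ (by linarith [hx.2])]
            nlinarith [hx.1, hx.2]
          linarith
        have h2 := Real.log_nonpos hx.1.le (by linarith [hx.2])
        nlinarith
  have hG2 : G (1 / 2) = Real.pi ^ 2 / 6 := by
    refine tendsto_nhds_unique (tendsto_const_nhds.congr' ?_) (by simpa using hlim)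
    exact hmem.mono fun x hx => (hGconst x hx).symm
  have hDhalf : D (1 / 2) = Real.pi ^ 2 / 12 - Real.log 2 ^ 2 / 2 := by
    have hl : Real.log (1 / 2) = -Real.log 2 := by rw [one_div, Real.log_inv]
    simp only [hG] at hG2
    rw [show (1 : ℝ) - 1 / 2 = 1 / 2 by norm_num, hl] at hG2
    linarith
  rw [← hDhalf]
  refine hasSum_of_eq (hsum (1 / 2) (by norm_num)).hasSum (fun n => ?_) rfl
  rw [one_div_pow, one_div_pow]
  ring

theorem hasSum_half_pow_shift_three : HasSum (fun k : ℕ => (1 / 2 ^ (k + 3) : ℝ)) (1 / 4) := by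
  refine hasSum_of_eq (hasSum_geometric_two.mul_left (1 / 8 : ℝ)) (fun k => ?_) ?_
  · rw [one_div_pow]; ring
  · norm_num

theorem hasSum_half_pow_div_shift_three :
    HasSum (fun k : ℕ => (1 / 2 ^ (k + 3) : ℝ) * (1 / ((k : ℝ) + 3))) (Real.log 2 - 5 / 8) := by
  have h := Real.hasSum_pow_div_log_of_abs_lt_one (x := 1 / 2) (by norm_num [abs_of_pos])
  rw [show (1 : ℝ) - 1 / 2 = 2⁻¹ by norm_num, Real.log_inv, neg_neg] at h
  have h2 := (hasSum_nat_add_iff' 2).2 h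
  refine hasSum_of_eq h2 (fun k => ?_) ?_
  · rw [one_div_pow]
    push_cast
    ring
  · norm_num [Finset.sum_range_succ]

theorem hasSum_half_pow_div_sq_shift_three :
    HasSum (fun k : ℕ => (1 / 2 ^ (k + 3) : ℝ) * (1 / ((k : ℝ) + 3)) ^ 2)
      (Real.pi ^ 2 / 12 - Real.log 2 ^ 2 / 2 - 9 / 16) := by
  refine hasSum_of_eq ((hasSum_nat_add_iff' 2).2 hasSum_dilog_one_half) (fun k => ?_) ?_
  · push_cast
    ring
  · norm_num [Finset.sum_range_succ]

/-- The second moment of the tail `{1/k : k ≥ 3}` about a point `c`. -/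
theorem hasSum_tail_sq_dist (c : ℝ) :
    HasSum (fun k : ℕ => (1 / 2 ^ (k + 3) : ℝ) * (1 / ((k : ℝ) + 3) - c) ^ 2)
      ((2 * Real.pi ^ 2 - 51 - 108 * (Real.log 2) ^ 2 + 120 * Real.log 2) / 24
        + (c - (4 * Real.log 2 - 5 / 2)) ^ 2 / 4) := by
  have h := (hasSum_half_pow_div_sq_shift_three.sub
    (hasSum_half_pow_div_shift_three.mul_left (2 * c))).add
      (hasSum_half_pow_shift_three.mul_left (c ^ 2))
  refine hasSum_of_eq h (fun k => ?_) ?_ <;> ring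

theorem avRTail_three : avRTail 3 = 4 * Real.log 2 - 5 / 2 := by
  have h1 := hasSum_half_pow_div_shift_three.tsum_eq
  have h2 := hasSum_half_pow_shift_three.tsum_eq
  simp only [avRTail, Nat.cast_ofNat]
  rw [h1, h2]
  ring

theorem errR_term_nonneg (α : Finset ℝ) (h : α.Nonempty) (k : ℕ) :
    0 ≤ (1 / 2 ^ (k + 1) : ℝ) * α.inf' h (fun a => (1 / (k + 1 : ℝ) - a) ^ 2) :=
  mul_nonneg (by positivity) (Finset.le_inf' _ _ fun _ _ => sq_nonneg _)

theorem summable_errR (α : Finset ℝ) (h : α.Nonempty) :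
    Summable fun k : ℕ =>
      (1 / 2 ^ (k + 1) : ℝ) * α.inf' h (fun a => (1 / (k + 1 : ℝ) - a) ^ 2) := by
  obtain ⟨a, ha⟩ := id h
  rw [← summable_nat_add_iff 2]
  refine Summable.of_nonneg_of_le (fun k => errR_term_nonneg α h (k + 2)) (fun k => ?_)
    (hasSum_tail_sq_dist a).summable
  refine (mul_le_mul_of_nonneg_left (Finset.inf'_le _ ha) (by positivity)).trans_eq ?_
  push_cast
  ring

theorem errR_eq_add_tail (α : Finset ℝ) (h : α.Nonempty) :
    errR α h = 1 / 2 * α.inf' h (fun a => (1 - a) ^ 2)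
      + 1 / 4 * α.inf' h (fun a => (1 / 2 - a) ^ 2)
      + ∑' k : ℕ, (1 / 2 ^ (k + 3) : ℝ) * α.inf' h (fun a => (1 / ((k : ℝ) + 3) - a) ^ 2) := by
  rw [errR, ← (summable_errR α h).sum_add_tsum_nat_add 2]
  congr 1
  · simp only [Finset.sum_range_succ, Finset.range_zero, Finset.sum_empty, Nat.cast_zero,
      Nat.cast_one, zero_add, pow_one, div_one, one_add_one_eq_two]
    rw [show (2 : ℝ) ^ 2 = 4 by norm_num]
  · refine tsum_congr fun k => ?_
    push_cast
    rw [show (k : ℝ) + 2 + 1 = k + 3 by ring]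

theorem summable_tail_errR (α : Finset ℝ) (h : α.Nonempty) :
    Summable fun k : ℕ =>
      (1 / 2 ^ (k + 3) : ℝ) * α.inf' h (fun a => (1 / ((k : ℝ) + 3) - a) ^ 2) := by
  refine ((summable_nat_add_iff 2).2 (summable_errR α h)).congr fun k => ?_
  push_cast
  rw [show (k : ℝ) + 2 + 1 = k + 3 by ring]

theorem le_of_nearest {x y a b : ℝ} (hxy : x < y) (ha : (x - a) ^ 2 ≤ (x - b) ^ 2)
    (hb : (y - b) ^ 2 ≤ (y - a) ^ 2) : a ≤ b := by
  by_contra! hlt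
  nlinarith [mul_pos (sub_pos.2 hxy) (sub_pos.2 hlt)]

theorem sq_sub_le_of_nearest {x z a b : ℝ} (hzx : z ≤ x) (hab : a ≤ b)
    (ha : (x - a) ^ 2 ≤ (x - b) ^ 2) : (z - a) ^ 2 ≤ (z - b) ^ 2 := by
  nlinarith [mul_nonneg (sub_nonneg.2 hzx) (sub_nonneg.2 hab)]

theorem quantization_value_lt :
    (2 * Real.pi ^ 2 - 51 - 108 * (Real.log 2) ^ 2 + 120 * Real.log 2) / 24 < 1 / 432 := by
  have h1 := Real.log_two_gt_d9
  have h2 := Real.log_two_lt_d9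
  have h3 := Real.pi_lt_d6
  have h4 := Real.pi_pos
  nlinarith

theorem le_errR (α : Finset ℝ) (h : α.Nonempty) (hcard : α.card ≤ 3) :
    (2 * Real.pi ^ 2 - 51 - 108 * (Real.log 2) ^ 2 + 120 * Real.log 2) / 24 ≤ errR α h := by
  obtain ⟨a, ha, ha_eq⟩ := α.exists_mem_eq_inf' h (fun a => ((1 : ℝ) - a) ^ 2)
  obtain ⟨b, hb, hb_eq⟩ := α.exists_mem_eq_inf' h (fun a => ((1 / 2 : ℝ) - a) ^ 2)
  obtain ⟨c, hc, hc_eq⟩ := α.exists_mem_eq_inf' h (fun a => ((1 / 3 : ℝ) - a) ^ 2)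
  have ha_min : ∀ x ∈ α, (1 - a) ^ 2 ≤ (1 - x) ^ 2 := fun x hx => ha_eq ▸ Finset.inf'_le _ hx
  have hb_min : ∀ x ∈ α, (1 / 2 - b) ^ 2 ≤ (1 / 2 - x) ^ 2 :=
    fun x hx => hb_eq ▸ Finset.inf'_le _ hx
  have hc_min : ∀ x ∈ α, (1 / 3 - c) ^ 2 ≤ (1 / 3 - x) ^ 2 :=
    fun x hx => hc_eq ▸ Finset.inf'_le _ hx
  have herr := errR_eq_add_tail α h
  rw [ha_eq, hb_eq] at herr
  have hfirst : 1 / 8 * (1 / 3 - c) ^ 2 ≤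
      ∑' k : ℕ, (1 / 2 ^ (k + 3) : ℝ) * α.inf' h (fun a => (1 / ((k : ℝ) + 3) - a) ^ 2) := by
    have h0 := (summable_tail_errR α h).le_tsum 0 fun k _ =>
      mul_nonneg (by positivity) (Finset.le_inf' _ _ fun _ _ => sq_nonneg _)
    refine le_trans (le_of_eq ?_) h0
    simp only [Nat.cast_zero, zero_add]
    rw [hc_eq]
    norm_num only
  have hV := quantization_value_lt
  by_cases hab : a = b
  · subst hab
    nlinarith [sq_nonneg (a - 5 / 6), sq_nonneg (1 / 3 - c)]
  by_cases hbc : b = c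
  · subst hbc
    nlinarith [sq_nonneg (b - 4 / 9), sq_nonneg (1 - a)]
  by_cases hac : a = c
  · subst hac
    nlinarith [sq_nonneg (a - 13 / 15), sq_nonneg (1 / 2 - b)]
  have hα : α = {a, b, c} := by
    refine (Finset.eq_of_subset_of_card_le ?_ ?_).symm
    · intro x hx
      simp only [Finset.mem_insert, Finset.mem_singleton] at hx
      rcases hx with rfl | rfl | rfl <;> assumption
    · rw [Finset.card_eq_three.2 ⟨a, b, c, hab, hac, hbc, rfl⟩]
      exact hcard
  have hcb : c ≤ b := le_of_nearest (by norm_num) (hc_min b hb) (hb_min c hc)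
  have hca : c ≤ a := le_of_nearest (by norm_num) (hc_min a ha) (ha_min c hc)
  have htail : (2 * Real.pi ^ 2 - 51 - 108 * (Real.log 2) ^ 2 + 120 * Real.log 2) / 24
        + (c - (4 * Real.log 2 - 5 / 2)) ^ 2 / 4 ≤
      ∑' k : ℕ, (1 / 2 ^ (k + 3) : ℝ) * α.inf' h (fun a => (1 / ((k : ℝ) + 3) - a) ^ 2) := by
    refine hasSum_le (fun k => ?_) (hasSum_tail_sq_dist c) (summable_tail_errR α h).hasSum
    refine mul_le_mul_of_nonneg_left (Finset.le_inf' _ _ fun x hx => ?_) (by positivity)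
    have hk : 1 / ((k : ℝ) + 3) ≤ 1 / 3 := by
      gcongr
      simp
    have hcx : c ≤ x := by
      rw [hα] at hx
      simp only [Finset.mem_insert, Finset.mem_singleton] at hx
      rcases hx with rfl | rfl | rfl
      exacts [hca, hcb, le_rfl]
    exact sq_sub_le_of_nearest hk hcx (hc_min x hx)
  nlinarith [sq_nonneg (c - (4 * Real.log 2 - 5 / 2)), sq_nonneg (1 - a), sq_nonneg (1 / 2 - b)]

theorem errR_le (α : Finset ℝ) (h : α.Nonempty) (h1 : 1 ∈ α) (h2 : 1 / 2 ∈ α)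
    (ha : avRTail 3 ∈ α) :
    errR α h ≤ (2 * Real.pi ^ 2 - 51 - 108 * (Real.log 2) ^ 2 + 120 * Real.log 2) / 24 := by
  have hinf1 : α.inf' h (fun a => ((1 : ℝ) - a) ^ 2) ≤ 0 :=
    (Finset.inf'_le _ h1).trans_eq (by norm_num)
  have hinf2 : α.inf' h (fun a => ((1 / 2 : ℝ) - a) ^ 2) ≤ 0 :=
    (Finset.inf'_le _ h2).trans_eq (by norm_num)
  have htail := hasSum_le
    (fun k : ℕ => mul_le_mul_of_nonneg_left
      (Finset.inf'_le (fun a : ℝ => (1 / ((k : ℝ) + 3) - a) ^ 2) ha)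
      (show (0 : ℝ) ≤ 1 / 2 ^ (k + 3) by positivity))
    (summable_tail_errR α h).hasSum (hasSum_tail_sq_dist (avRTail 3))
  rw [avRTail_three, sub_self] at htail
  rw [errR_eq_add_tail]
  linarith

theorem stmt10 :
    sInf {v : ℝ | ∃ (α : Finset ℝ) (h : α.Nonempty), α.card ≤ 3 ∧ v = errR α h}
      = (2 * Real.pi^2 - 51 - 108 * (Real.log 2)^2 + 120 * Real.log 2) / 24 ∧
    errR {avRTail 3, 1/2, 1} (by simp) =
      (2 * Real.pi^2 - 51 - 108 * (Real.log 2)^2 + 120 * Real.log 2) / 24 := by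
  have heq : errR {avRTail 3, 1/2, 1} (by simp) =
      (2 * Real.pi^2 - 51 - 108 * (Real.log 2)^2 + 120 * Real.log 2) / 24 :=
    le_antisymm (errR_le _ _ (by simp) (by simp) (by simp)) (le_errR _ _ Finset.card_le_three)
  refine ⟨IsLeast.csInf_eq ⟨⟨_, _, Finset.card_le_three, heq.symm⟩, ?_⟩, heq⟩
  rintro v ⟨α, h, hcard, rfl⟩
  exact le_errR α h hcard
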